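/- Let θ ∈ (0,1), α > 0 and 0 < ν < 1. There exists a constant C = C(ν, θ, α) such that for all 0 < σ₂ ≤ σ₁ < 1, every t ≥ 1, and all vectors v, u₁, u₂ ∈ ℝ³ with |v| ≤ ν, |u₁| ≤ ν, |u₂| ≤ ν, one has |γ_{σ₂}(v, u₂, t) − γ_{σ₁}(v, u₁, t)| ≤ C ( |u₂ − u₁| t^{1−θ} + σ₁ t ). -/

import Mathlib

open MeasureTheory
open scoped RealInnerProductSpace

noncomputable section

/-- ℝ³ as a Euclidean space. -/
abbrev E3 := EuclideanSpace ℝ (Fin 3)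

/-- The closed annulus `{k : a ≤ |k| ≤ b}` in ℝ³. -/
def annulus (a b : ℝ) : Set E3 := {k | a ≤ ‖k‖ ∧ ‖k‖ ≤ b}

/-- The soft-photon velocity field
`Σ_v(k) = (2 / (|k|² (1 − (k/|k|)·v))) • (v − ((k·v)/|k|²) k)`. -/
def Sig (v k : E3) : E3 :=
  (2 / (‖k‖ ^ 2 * (1 - ⟪k, v⟫ / ‖k‖))) • (v - (⟪k, v⟫ / ‖k‖ ^ 2) • k)

/-- The infrared phase
`γ_σ(v,u,t) = −α ∫₁^{min(t, σ^{−1/θ})} u · ( ∫_{A(σ, τ^{−θ})} Σ_v(k) cos(k·u τ − |k| τ) dk ) dτ`.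
(The inner integral is automatically `0` when `τ^{−θ} < σ`, since then the annulus is empty.) -/
def gammaIR (α θ : ℝ) (v u : E3) (σ t : ℝ) : ℝ :=
  -α * ∫ τ in (1:ℝ)..(min t (σ ^ (-(1/θ)))),
    ⟪u, ∫ k in annulus σ (τ ^ (-θ)),
        Real.cos (⟪k, u⟫ * τ - ‖k‖ * τ) • Sig v k⟫


open Metric in
lemma polar (f : E3 → E3) (hf : Integrable f volume) :
    ∫ x, f x = ∫ ω : sphere (0 : E3) 1, (∫ r in Set.Ioi (0:ℝ), r ^ 2 • f (r • (ω : E3)))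
      ∂((volume : Measure E3).toSphere) := by
  have hd : Module.finrank ℝ E3 - 1 = 2 := by simp
  have hmp := (volume : Measure E3).measurePreserving_homeomorphUnitSphereProd
  rw [hd] at hmp
  set g : sphere (0 : E3) 1 × Set.Ioi (0:ℝ) → E3 := fun p => f ((p.2 : ℝ) • (p.1 : E3)) with hg
  have hcomp : ∀ x : ({(0)}ᶜ : Set E3), g (homeomorphUnitSphereProd E3 x) = f x := by
    intro x
    have hx : ‖(x : E3)‖ ≠ 0 := norm_ne_zero_iff.2 x.2
    simp [hg, smul_smul, hx]
  have hgi : Integrable g ((volume : Measure E3).toSphere.prod (Measure.volumeIoiPow 2)) := by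
    rw [← hmp.integrable_comp_emb (Homeomorph.measurableEmbedding _)]
    have : (g ∘ homeomorphUnitSphereProd E3) = f ∘ Subtype.val := funext hcomp
    rw [this, ← integrableOn_iff_comap_subtypeVal (measurableSet_singleton _).compl]
    exact hf.integrableOn
  calc
    ∫ x, f x = ∫ x : ({(0)}ᶜ : Set E3), f x ∂(Measure.comap Subtype.val volume) := by
      rw [integral_subtype_comap (measurableSet_singleton _).compl fun x ↦ f x,
        restrict_compl_singleton]
    _ = ∫ x, g x ∂((volume : Measure E3).toSphere.prod (Measure.volumeIoiPow 2)) := by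
      rw [← hmp.integral_comp (Homeomorph.measurableEmbedding _)]
      simp_rw [hcomp]
    _ = ∫ ω, ∫ r, g (ω, r) ∂(Measure.volumeIoiPow 2) ∂((volume : Measure E3).toSphere) :=
      integral_prod _ hgi
    _ = _ := by
      congr 1
      ext1 ω
      simp only [Measure.volumeIoiPow, ENNReal.ofReal]
      rw [integral_withDensity_eq_integral_smul]
      · simp only [hg]
        rw [integral_subtype_comap measurableSet_Ioi
            fun a ↦ Real.toNNReal (a ^ 2) • f (a • (ω : E3)),
          setIntegral_congr_fun measurableSet_Ioi fun x hx ↦ ?_]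
        rw [NNReal.smul_def, Real.coe_toNNReal _ (sq_nonneg _)]
      · exact (measurable_subtype_coe.pow_const _).real_toNNReal

lemma one_sub_pos (ν : ℝ) (v k : E3) (hv : ‖v‖ ≤ ν) :
    1 - ν ≤ 1 - ⟪k, v⟫ / ‖k‖ := by
  have h := real_inner_le_norm k v
  rcases eq_or_lt_of_le (norm_nonneg k) with h0 | h0
  · rw [← h0]; simp; linarith [norm_nonneg v]
  · have : ⟪k, v⟫ / ‖k‖ ≤ ν := by
      rw [div_le_iff₀ h0]; nlinarith
    linarith

lemma Sig_bound (ν : ℝ) (hν1 : ν < 1) (v k : E3) (hv : ‖v‖ ≤ ν) (hk : k ≠ 0) :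
    ‖Sig v k‖ ≤ 4 / (1 - ν) / ‖k‖ ^ 2 := by
  have h0 : 0 < ‖k‖ := norm_pos_iff.2 hk
  have h1 := one_sub_pos ν v k hv
  have h1' : 0 < 1 - ν := by linarith
  have h2 : ‖v - (⟪k, v⟫ / ‖k‖ ^ 2) • k‖ ≤ 2 := by
    refine (norm_sub_le _ _).trans ?_
    rw [norm_smul, Real.norm_eq_abs, abs_div, abs_of_pos (pow_pos h0 2)]
    have : |⟪k, v⟫| / ‖k‖ ^ 2 * ‖k‖ ≤ ‖v‖ := by
      rw [div_mul_eq_mul_div, div_le_iff₀ (by positivity)]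
      have := abs_real_inner_le_norm k v
      nlinarith
    linarith
  unfold Sig
  rw [norm_smul, Real.norm_eq_abs, abs_of_pos (by have := h1'.trans_le h1; positivity)]
  have h3 : 2 / (‖k‖ ^ 2 * (1 - ⟪k, v⟫ / ‖k‖)) ≤ 2 / (‖k‖ ^ 2 * (1 - ν)) := by gcongr
  calc _ ≤ 2 / (‖k‖ ^ 2 * (1 - ν)) * 2 := by gcongr
    _ = _ := by field_simp; norm_num

lemma Sig_smul (v k : E3) (r : ℝ) (hr : 0 < r) : r ^ 2 • Sig v (r • k) = Sig v k := by
  unfold Sig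
  rw [smul_smul, norm_smul, real_inner_smul_left, Real.norm_eq_abs, abs_of_pos hr,
    mul_div_mul_left _ _ hr.ne', smul_smul]
  congr 1
  · rw [mul_pow, mul_assoc]; field_simp
  · congr 2
    field_simp

lemma Sig_meas (v : E3) : Measurable (Sig v) := by
  unfold Sig; fun_prop

lemma annulus_meas (a b : ℝ) : MeasurableSet (annulus a b) := by
  unfold annulus
  exact (measurableSet_le measurable_const measurable_norm).inter
    (measurableSet_le measurable_norm measurable_const)

lemma intOn (ν : ℝ) (hν1 : ν < 1) (v u : E3) (hv : ‖v‖ ≤ ν) (a b τ : ℝ) (ha : 0 < a) :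
    IntegrableOn (fun k => Real.cos (⟪k, u⟫ * τ - ‖k‖ * τ) • Sig v k) (annulus a b) := by
  have hfin : volume (annulus a b) < ⊤ := by
    refine (measure_mono ?_).trans_lt (measure_closedBall_lt_top (x := (0:E3)) (r := b))
    intro k hk
    simpa using hk.2
  refine IntegrableOn.of_bound hfin ?_ (4 / (1 - ν) / a ^ 2) ?_
  · have := Sig_meas v
    exact Measurable.aestronglyMeasurable (by fun_prop)
  · filter_upwards [ae_restrict_mem (annulus_meas a b)] with k hk
    have hk0 : 0 < ‖k‖ := ha.trans_le hk.1
    have h1 := Sig_bound ν hν1 v k hv (norm_pos_iff.1 hk0)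
    rw [norm_smul, Real.norm_eq_abs]
    have h2 := Real.abs_cos_le_one (⟪k, u⟫ * τ - ‖k‖ * τ)
    have h1' : 0 < 1 - ν := by linarith
    have h3 : 4 / (1 - ν) / ‖k‖ ^ 2 ≤ 4 / (1 - ν) / a ^ 2 := by
      gcongr; exact hk.1
    nlinarith [norm_nonneg (Sig v k), abs_nonneg (Real.cos (⟪k, u⟫ * τ - ‖k‖ * τ))]

/-- explicit radial integral -/
def JJ (a b c : ℝ) : ℝ := (Real.sin (max a b * c) - Real.sin (a * c)) / c

lemma JJ_eq (a b c : ℝ) (hc : c ≠ 0) : ∫ r in Set.Icc a b, Real.cos (r * c) = JJ a b c := by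
  unfold JJ
  rcases le_total a b with h | h
  · rw [integral_Icc_eq_integral_Ioc, ← intervalIntegral.integral_of_le h, max_eq_right h,
      intervalIntegral.integral_comp_mul_right _ hc, integral_cos, smul_eq_mul]
    field_simp
  · have : volume (Set.Icc a b) = 0 := by rw [Real.volume_Icc]; simp [h]
    rw [max_eq_left h, Measure.restrict_eq_zero.2 this]; simp

lemma inner_eq (ν : ℝ) (hν1 : ν < 1) (v u : E3) (hv : ‖v‖ ≤ ν) (hu : ‖u‖ ≤ ν) (a b τ : ℝ)
    (ha : 0 < a) (hτ : 0 < τ) :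
    ∫ k in annulus a b, Real.cos (⟪k, u⟫ * τ - ‖k‖ * τ) • Sig v k =
      ∫ ω : Metric.sphere (0 : E3) 1, JJ a b (τ * (1 - ⟪(ω : E3), u⟫)) • Sig v ω
        ∂((volume : Measure E3).toSphere) := by
  rw [← integral_indicator (annulus_meas a b), polar _
    ((integrable_indicator_iff (annulus_meas a b)).2 (intOn ν hν1 v u hv a b τ ha))]
  congr 1
  ext1 ω
  have hω : ‖(ω : E3)‖ = 1 := by simp
  have hc : τ * (1 - ⟪(ω : E3), u⟫) ≠ 0 := by
    have := real_inner_le_norm (ω : E3) u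
    rw [hω] at this
    have : 0 < 1 - ⟪(ω : E3), u⟫ := by linarith
    positivity
  rw [← JJ_eq a b _ hc, ← integral_smul_const,
    ← integral_indicator measurableSet_Icc, ← integral_indicator measurableSet_Ioi]
  congr 1
  ext1 r
  by_cases hr : r ∈ Set.Icc a b
  · have hr0 : 0 < r := ha.trans_le hr.1
    have hm : r • (ω : E3) ∈ annulus a b := by
      simp only [annulus, Set.mem_ofPred_eq, norm_smul, hω, Real.norm_eq_abs, abs_of_pos hr0]
      simpa using hr
    rw [Set.indicator_of_mem (Set.mem_Ioi.2 hr0), Set.indicator_of_mem hm,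
      Set.indicator_of_mem hr, smul_comm, Sig_smul _ _ _ hr0]
    congr 1
    rw [← Real.cos_neg, norm_smul, hω, real_inner_smul_left, Real.norm_eq_abs, abs_of_pos hr0]
    congr 1; ring
  · rw [Set.indicator_of_notMem hr]
    by_cases hr0 : 0 < r
    · have hm : r • (ω : E3) ∉ annulus a b := by
        simp only [annulus, Set.mem_ofPred_eq, norm_smul, hω, Real.norm_eq_abs, abs_of_pos hr0]
        simpa using hr
      rw [Set.indicator_of_mem (Set.mem_Ioi.2 hr0), Set.indicator_of_notMem hm, smul_zero]
    · rw [Set.indicator_of_notMem (by simpa using hr0)]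

lemma JJ_abs (a b c : ℝ) (ha : 0 ≤ a) (hb : 0 ≤ b) (hc : 0 < c) : |JJ a b c| ≤ b := by
  unfold JJ
  rw [abs_div, abs_of_pos hc, div_le_iff₀ hc]
  refine (Real.abs_sin_sub_sin_le _ _).trans ?_
  rw [← sub_mul, abs_mul, abs_of_pos hc]
  gcongr
  rw [abs_of_nonneg (by simp)]
  rcases le_total a b with h | h
  · rw [max_eq_right h]; linarith
  · rw [max_eq_left h]; linarith

lemma JJ_cut (a₁ a₂ b c : ℝ) (ha : 0 ≤ a₂) (ha' : a₂ ≤ a₁) (hc : 0 < c) :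
    |JJ a₂ b c - JJ a₁ b c| ≤ 2 * a₁ := by
  unfold JJ
  rw [← sub_div, abs_div, abs_of_pos hc, div_le_iff₀ hc]
  have h1 := Real.abs_sin_sub_sin_le (max a₂ b * c) (max a₁ b * c)
  have h2 := Real.abs_sin_sub_sin_le (a₁ * c) (a₂ * c)
  rw [← sub_mul, abs_mul, abs_of_pos hc] at h1 h2
  have h3 : |max a₂ b - max a₁ b| ≤ a₁ := by
    refine (abs_max_sub_max_le_abs _ _ _).trans ?_
    rw [abs_le]; constructor <;> linarith
  have h4 : |a₁ - a₂| ≤ a₁ := by rw [abs_le]; constructor <;> linarith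
  have h5 := abs_add_le (Real.sin (max a₂ b * c) - Real.sin (max a₁ b * c))
    (Real.sin (a₁ * c) - Real.sin (a₂ * c))
  have h6 : |max a₂ b - max a₁ b| * c ≤ a₁ * c := by gcongr
  have h7 : |a₁ - a₂| * c ≤ a₁ * c := by gcongr
  calc _ = _ := by congr 1; ring
    _ ≤ _ := h5
    _ ≤ _ := by linarith

lemma sinc_lip (b c d : ℝ) (hb : 0 ≤ b) (hc : 0 < c) (hd : 0 < d) :
    |Real.sin (b * d) / d - Real.sin (b * c) / c| ≤ 2 * b * |d - c| / d := by
  have e : Real.sin (b * d) / d - Real.sin (b * c) / c =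
      ((Real.sin (b * d) - Real.sin (b * c)) + Real.sin (b * c) / c * (c - d)) / d := by
    field_simp; ring
  rw [e, abs_div, abs_of_pos hd]
  gcongr
  have h1 := Real.abs_sin_sub_sin_le (b * d) (b * c)
  rw [← mul_sub, abs_mul, abs_of_nonneg hb] at h1
  have h2 : |Real.sin (b * c) / c| ≤ b := by
    rw [abs_div, abs_of_pos hc, div_le_iff₀ hc]
    simpa [abs_of_nonneg hb, abs_of_pos hc] using Real.abs_sin_le_abs (x := b * c)
  refine (abs_add_le _ _).trans ?_
  rw [abs_mul, abs_sub_comm c d]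
  nlinarith [abs_nonneg (d - c)]

lemma JJ_lip (a b c d : ℝ) (ha : 0 ≤ a) (hb : 0 ≤ b) (hc : 0 < c) (hd : 0 < d) :
    |JJ a b d - JJ a b c| ≤ 4 * b * |d - c| / d := by
  unfold JJ
  rcases le_total a b with h | h
  · rw [max_eq_right h]
    have h1 := sinc_lip b c d hb hc hd
    have h2 := sinc_lip a c d ha hc hd
    have h3 : 2 * a * |d - c| / d ≤ 2 * b * |d - c| / d := by gcongr
    have h5 := abs_sub (Real.sin (b * d) / d - Real.sin (b * c) / c)
      (Real.sin (a * d) / d - Real.sin (a * c) / c)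
    calc _ = _ := by congr 1; ring
      _ ≤ _ := h5
      _ ≤ 2 * b * |d - c| / d + 2 * b * |d - c| / d := by linarith
      _ = _ := by ring
  · rw [max_eq_left h]; simp; positivity

abbrev S2 := Metric.sphere (0 : E3) 1

abbrev mS : Measure S2 := (volume : Measure E3).toSphere

/-- angular form of the inner integral -/
def GG (v u : E3) (a b τ : ℝ) : E3 :=
  ∫ ω : S2, JJ a b (τ * (1 - ⟪(ω : E3), u⟫)) • Sig v ω ∂mS

lemma c_pos (ν : ℝ) (hν1 : ν < 1) (u : E3) (hu : ‖u‖ ≤ ν) (τ : ℝ) (hτ : 0 < τ) (ω : S2) :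
    τ * (1 - ν) ≤ τ * (1 - ⟪(ω : E3), u⟫) ∧ 0 < τ * (1 - ⟪(ω : E3), u⟫) := by
  have hω : ‖(ω : E3)‖ = 1 := by simp
  have := real_inner_le_norm (ω : E3) u
  rw [hω] at this
  have h1 : 1 - ν ≤ 1 - ⟪(ω : E3), u⟫ := by linarith
  have h2 : 0 < 1 - ⟪(ω : E3), u⟫ := by linarith
  exact ⟨by gcongr, by positivity⟩

lemma Sig_sphere (ν : ℝ) (hν1 : ν < 1) (v : E3) (hv : ‖v‖ ≤ ν) (ω : S2) :
    ‖Sig v ω‖ ≤ 4 / (1 - ν) := by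
  have hω : ‖(ω : E3)‖ = 1 := by simp
  have := Sig_bound ν hν1 v ω hv (by intro h; rw [h] at hω; simp at hω)
  simpa [hω] using this

lemma joint_meas (v u : E3) (a θ : ℝ) :
    Measurable (fun p : ℝ × S2 => JJ a (p.1 ^ (-θ)) (p.1 * (1 - ⟪(p.2 : E3), u⟫)) • Sig v p.2) := by
  have := Sig_meas v
  unfold JJ
  fun_prop

lemma om_meas (v u : E3) (a b τ : ℝ) :
    Measurable (fun ω : S2 => JJ a b (τ * (1 - ⟪(ω : E3), u⟫)) • Sig v ω) := by
  have := Sig_meas v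
  unfold JJ
  fun_prop

lemma om_bd (ν : ℝ) (hν1 : ν < 1) (v u : E3) (hv : ‖v‖ ≤ ν) (hu : ‖u‖ ≤ ν) (a b τ : ℝ)
    (ha : 0 ≤ a) (hb : 0 ≤ b) (hτ : 0 < τ) (ω : S2) :
    ‖JJ a b (τ * (1 - ⟪(ω : E3), u⟫)) • Sig v ω‖ ≤ b * (4 / (1 - ν)) := by
  rw [norm_smul, Real.norm_eq_abs]
  have h1 := JJ_abs a b _ ha hb (c_pos ν hν1 u hu τ hτ ω).2
  have h2 := Sig_sphere ν hν1 v hv ω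
  gcongr

lemma om_int (ν : ℝ) (hν1 : ν < 1) (v u : E3) (hv : ‖v‖ ≤ ν) (hu : ‖u‖ ≤ ν) (a b τ : ℝ)
    (ha : 0 ≤ a) (hb : 0 ≤ b) (hτ : 0 < τ) :
    Integrable (fun ω : S2 => JJ a b (τ * (1 - ⟪(ω : E3), u⟫)) • Sig v ω) mS :=
  Integrable.of_bound (om_meas v u a b τ).aestronglyMeasurable _
    (Filter.Eventually.of_forall (om_bd ν hν1 v u hv hu a b τ ha hb hτ))

lemma GG_bd (ν : ℝ) (hν1 : ν < 1) (v u : E3) (hv : ‖v‖ ≤ ν) (hu : ‖u‖ ≤ ν) (a b τ : ℝ)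
    (ha : 0 ≤ a) (hb : 0 ≤ b) (hτ : 0 < τ) :
    ‖GG v u a b τ‖ ≤ b * (4 / (1 - ν)) * mS.real Set.univ :=
  norm_integral_le_of_norm_le_const
    (Filter.Eventually.of_forall (om_bd ν hν1 v u hv hu a b τ ha hb hτ))

lemma GG_diff (ν : ℝ) (hν1 : ν < 1) (v u₁ u₂ : E3) (hv : ‖v‖ ≤ ν) (hu₁ : ‖u₁‖ ≤ ν)
    (hu₂ : ‖u₂‖ ≤ ν) (a₁ a₂ b τ : ℝ)
    (ha : 0 ≤ a₂) (ha' : a₂ ≤ a₁) (hb : 0 ≤ b) (hτ : 0 < τ) :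
    ‖GG v u₂ a₂ b τ - GG v u₁ a₁ b τ‖ ≤
      (2 * a₁ + 4 * b * ‖u₂ - u₁‖ / (1 - ν)) * (4 / (1 - ν)) * mS.real Set.univ := by
  unfold GG
  rw [← integral_sub (om_int ν hν1 v u₂ hv hu₂ a₂ b τ ha hb hτ)
    (om_int ν hν1 v u₁ hv hu₁ a₁ b τ (ha.trans ha') hb hτ)]
  refine norm_integral_le_of_norm_le_const (Filter.Eventually.of_forall fun ω => ?_)
  rw [← sub_smul, norm_smul, Real.norm_eq_abs]
  have hc₁ := c_pos ν hν1 u₁ hu₁ τ hτ ω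
  have hc₂ := c_pos ν hν1 u₂ hu₂ τ hτ ω
  set c₁ := τ * (1 - ⟪(ω : E3), u₁⟫) with e1
  set c₂ := τ * (1 - ⟪(ω : E3), u₂⟫) with e2
  have h2 := Sig_sphere ν hν1 v hv ω
  have hν : 0 < 1 - ν := by linarith
  have h1 := JJ_cut a₁ a₂ b c₂ ha ha' hc₂.2
  have h3 := JJ_lip a₁ b c₁ c₂ (ha.trans ha') hb hc₁.2 hc₂.2
  have h4 : |c₂ - c₁| ≤ τ * ‖u₂ - u₁‖ := by
    have : c₂ - c₁ = - (τ * ⟪(ω : E3), u₂ - u₁⟫) := by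
      rw [e1, e2, inner_sub_right]; ring
    rw [this, abs_neg, abs_mul, abs_of_pos hτ]
    have h := abs_real_inner_le_norm (ω : E3) (u₂ - u₁)
    have hω : ‖(ω : E3)‖ = 1 := by simp
    rw [hω, one_mul] at h
    gcongr
  have h5 : 4 * b * |c₂ - c₁| / c₂ ≤ 4 * b * ‖u₂ - u₁‖ / (1 - ν) := by
    calc _ ≤ 4 * b * (τ * ‖u₂ - u₁‖) / (τ * (1 - ν)) := by
          gcongr
          exact hc₂.1
      _ = _ := by field_simp
  have h6 : |JJ a₂ b c₂ - JJ a₁ b c₁| ≤ 2 * a₁ + 4 * b * ‖u₂ - u₁‖ / (1 - ν) := by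
    have := abs_sub_le (JJ a₂ b c₂) (JJ a₁ b c₂) (JJ a₁ b c₁)
    linarith
  have h7 := (abs_nonneg _).trans h6
  gcongr

lemma f_diff (ν : ℝ) (hν1 : ν < 1) (v u₁ u₂ : E3) (hv : ‖v‖ ≤ ν) (hu₁ : ‖u₁‖ ≤ ν)
    (hu₂ : ‖u₂‖ ≤ ν) (a₁ a₂ b τ : ℝ)
    (ha : 0 ≤ a₂) (ha' : a₂ ≤ a₁) (hb : 0 ≤ b) (hτ : 0 < τ) :
    |⟪u₂, GG v u₂ a₂ b τ⟫ - ⟪u₁, GG v u₁ a₁ b τ⟫| ≤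
      (4 / (1 - ν)) * mS.real Set.univ * (2 + 4 / (1 - ν)) * (‖u₂ - u₁‖ * b + a₁) := by
  have hν : 0 < 1 - ν := by linarith
  have e : ⟪u₂, GG v u₂ a₂ b τ⟫ - ⟪u₁, GG v u₁ a₁ b τ⟫ =
      ⟪u₂ - u₁, GG v u₂ a₂ b τ⟫ + ⟪u₁, GG v u₂ a₂ b τ - GG v u₁ a₁ b τ⟫ := by
    rw [inner_sub_left, inner_sub_right]; ring
  rw [e]
  have h1 := GG_bd ν hν1 v u₂ hv hu₂ a₂ b τ ha hb hτ
  have h2 := GG_diff ν hν1 v u₁ u₂ hv hu₁ hu₂ a₁ a₂ b τ ha ha' hb hτ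
  have h3 := abs_real_inner_le_norm (u₂ - u₁) (GG v u₂ a₂ b τ)
  have h4 := abs_real_inner_le_norm u₁ (GG v u₂ a₂ b τ - GG v u₁ a₁ b τ)
  have ha1 : 0 ≤ a₁ := ha.trans ha'
  calc _ ≤ _ := abs_add_le _ _
    _ ≤ ‖u₂ - u₁‖ * (b * (4 / (1 - ν)) * mS.real Set.univ) +
        1 * ((2 * a₁ + 4 * b * ‖u₂ - u₁‖ / (1 - ν)) * (4 / (1 - ν)) * mS.real Set.univ) := by
      have : ‖u₁‖ ≤ 1 := by linarith
      refine add_le_add (h3.trans (by gcongr)) (h4.trans (by gcongr))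
    _ = (4 / (1 - ν)) * mS.real Set.univ *
        (‖u₂ - u₁‖ * b * (1 + 4 / (1 - ν)) + 2 * a₁) := by ring
    _ ≤ (4 / (1 - ν)) * mS.real Set.univ *
        ((2 + 4 / (1 - ν)) * (‖u₂ - u₁‖ * b + a₁)) := by
      gcongr
      have h5 : 0 ≤ ‖u₂ - u₁‖ * b := by positivity
      have h6 : 0 ≤ 4 / (1 - ν) * a₁ := by positivity
      nlinarith
    _ = _ := by ring

lemma gamma_eq (α θ ν : ℝ) (hθ0 : 0 < θ) (hν1 : ν < 1) (v u : E3) (hv : ‖v‖ ≤ ν)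
    (hu : ‖u‖ ≤ ν) (σ t : ℝ) (hσ : 0 < σ) (hσ1 : σ < 1) (ht : 1 ≤ t) :
    gammaIR α θ v u σ t = -α * ∫ τ in (1:ℝ)..t, ⟪u, GG v u σ (τ ^ (-θ)) τ⟫ := by
  unfold gammaIR
  congr 1
  have hs : 1 ≤ σ ^ (-(1 / θ)) :=
    Real.one_le_rpow_of_pos_of_le_one_of_nonpos hσ hσ1.le (by simp; positivity)
  rw [intervalIntegral.integral_of_le (le_min ht hs), intervalIntegral.integral_of_le ht]
  have e : ∀ τ : ℝ, 0 < τ → GG v u σ (τ ^ (-θ)) τ = ∫ k in annulus σ (τ ^ (-θ)),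
        Real.cos (⟪k, u⟫ * τ - ‖k‖ * τ) • Sig v k := fun τ hτ =>
    (inner_eq ν hν1 v u hv hu σ (τ ^ (-θ)) τ hσ hτ).symm
  rw [setIntegral_congr_fun (g := fun τ => ⟪u, GG v u σ (τ ^ (-θ)) τ⟫) measurableSet_Ioc
    (fun τ hτ => by dsimp only; rw [e τ (by linarith [hτ.1])])]
  symm
  apply setIntegral_eq_of_subset_of_forall_sdiff_eq_zero measurableSet_Ioc
  · exact Set.Ioc_subset_Ioc_right (min_le_left _ _)
  · rintro τ ⟨h1, h2⟩
    have hτ : 0 < τ := by linarith [h1.1]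
    have h3 : σ ^ (-(1 / θ)) < τ := by
      by_contra h
      exact h2 ⟨h1.1, le_min h1.2 (not_lt.1 h)⟩
    have h4 : τ ^ (-θ) < σ := by
      have := Real.rpow_lt_rpow_of_neg (Real.rpow_pos_of_pos hσ _) h3 (neg_lt_zero.2 hθ0)
      rwa [← Real.rpow_mul hσ.le, show -(1 / θ) * -θ = 1 by field_simp, Real.rpow_one] at this
    have : annulus σ (τ ^ (-θ)) = ∅ := by
      ext k
      simp only [annulus, Set.mem_ofPred_eq, Set.mem_empty_iff_false, iff_false]
      intro h; linarith [h.1, h.2]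
    rw [e τ hτ, this]; simp

lemma f_int (θ ν : ℝ) (hθ0 : 0 < θ) (hν1 : ν < 1) (v u : E3) (hv : ‖v‖ ≤ ν)
    (hu : ‖u‖ ≤ ν) (σ t : ℝ) (hσ : 0 < σ) :
    IntegrableOn (fun τ => ⟪u, GG v u σ (τ ^ (-θ)) τ⟫) (Set.Ioc 1 t) := by
  have hν : 0 < 1 - ν := by linarith
  have hm : StronglyMeasurable (fun τ : ℝ => GG v u σ (τ ^ (-θ)) τ) :=
    (joint_meas v u σ θ).stronglyMeasurable.integral_prod_right' (ν := mS)
  refine IntegrableOn.of_bound measure_Ioc_lt_top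
    (stronglyMeasurable_const.inner hm).aestronglyMeasurable
    (1 * (4 / (1 - ν)) * mS.real Set.univ) ?_
  filter_upwards [ae_restrict_mem measurableSet_Ioc] with τ hτ
  have hτ0 : 0 < τ := by linarith [hτ.1]
  have h1 := GG_bd ν hν1 v u hv hu σ (τ ^ (-θ)) τ hσ.le (by positivity) hτ0
  have h2 : τ ^ (-θ) ≤ 1 := Real.rpow_le_one_of_one_le_of_nonpos hτ.1.le (by linarith)
  have h3 := abs_real_inner_le_norm u (GG v u σ (τ ^ (-θ)) τ)
  have hu' : ‖u‖ ≤ 1 := by linarith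
  rw [Real.norm_eq_abs]
  calc _ ≤ _ := h3
    _ ≤ 1 * (1 * (4 / (1 - ν)) * mS.real Set.univ) := by
      refine mul_le_mul hu' (h1.trans (by gcongr)) (norm_nonneg _) zero_le_one
    _ = _ := one_mul _

/-- Lemma A.1(ii): comparing the infrared phase at two infrared cutoffs
`σ₂ ≤ σ₁` and two velocities `u₂, u₁`. -/
theorem statement6 (θ α ν : ℝ) (hθ0 : 0 < θ) (hθ1 : θ < 1) (hα : 0 < α)
    (hν0 : 0 < ν) (hν1 : ν < 1) :
    ∃ C : ℝ, ∀ σ₁ σ₂ : ℝ, 0 < σ₂ → σ₂ ≤ σ₁ → σ₁ < 1 → ∀ t : ℝ, 1 ≤ t →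
      ∀ v u₁ u₂ : E3, ‖v‖ ≤ ν → ‖u₁‖ ≤ ν → ‖u₂‖ ≤ ν →
      |gammaIR α θ v u₂ σ₂ t - gammaIR α θ v u₁ σ₁ t| ≤
        C * (‖u₂ - u₁‖ * t ^ (1 - θ) + σ₁ * t) := by
  have hν : 0 < 1 - ν := by linarith
  have hθ : 0 < 1 - θ := by linarith
  set K : ℝ := (4 / (1 - ν)) * mS.real Set.univ * (2 + 4 / (1 - ν)) with hK
  have hK0 : 0 ≤ K := by positivity
  refine ⟨α * (K * (1 / (1 - θ))), ?_⟩
  intro σ₁ σ₂ h2 h21 h1 t ht v u₁ u₂ hv hu₁ hu₂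
  have hs1 : 0 < σ₁ := h2.trans_le h21
  rw [gamma_eq α θ ν hθ0 hν1 v u₂ hv hu₂ σ₂ t h2 (h21.trans_lt h1) ht,
    gamma_eq α θ ν hθ0 hν1 v u₁ hv hu₁ σ₁ t hs1 h1 ht, ← mul_sub, abs_mul, abs_neg,
    abs_of_pos hα, mul_assoc α]
  refine mul_le_mul_of_nonneg_left ?_ hα.le
  rw [← intervalIntegral.integral_sub
    ((intervalIntegrable_iff_integrableOn_Ioc_of_le ht).2
      (f_int θ ν hθ0 hν1 v u₂ hv hu₂ σ₂ t h2))
    ((intervalIntegrable_iff_integrableOn_Ioc_of_le ht).2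
      (f_int θ ν hθ0 hν1 v u₁ hv hu₁ σ₁ t hs1))]
  have hI : IntervalIntegrable (fun τ : ℝ => τ ^ (-θ)) volume 1 t :=
    intervalIntegral.intervalIntegrable_rpow' (by linarith)
  have hI2 : IntervalIntegrable (fun τ : ℝ => K * (‖u₂ - u₁‖ * τ ^ (-θ) + σ₁)) volume 1 t :=
    ((hI.const_mul _).add intervalIntegrable_const).const_mul _
  have hb := intervalIntegral.norm_integral_le_of_norm_le (μ := volume) (a := 1) (b := t)
    (f := fun τ : ℝ => ⟪u₂, GG v u₂ σ₂ (τ ^ (-θ)) τ⟫ - ⟪u₁, GG v u₁ σ₁ (τ ^ (-θ)) τ⟫)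
    (g := fun τ : ℝ => K * (‖u₂ - u₁‖ * τ ^ (-θ) + σ₁)) ht
    (Filter.Eventually.of_forall fun τ hτ => by
      have hτ0 : 0 < τ := by linarith [hτ.1]
      rw [Real.norm_eq_abs]
      exact f_diff ν hν1 v u₁ u₂ hv hu₁ hu₂ σ₁ σ₂ (τ ^ (-θ)) τ h2.le h21 (by positivity) hτ0)
    hI2
  rw [Real.norm_eq_abs] at hb
  refine hb.trans ?_
  rw [intervalIntegral.integral_const_mul, intervalIntegral.integral_add (hI.const_mul _)
    intervalIntegrable_const, intervalIntegral.integral_const_mul,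
    integral_rpow (Or.inl (by linarith)), intervalIntegral.integral_const, smul_eq_mul,
    mul_assoc K]
  refine mul_le_mul_of_nonneg_left ?_ hK0
  rw [show -θ + 1 = 1 - θ by ring, Real.one_rpow]
  have h3 : (t ^ (1 - θ) - 1) / (1 - θ) ≤ 1 / (1 - θ) * t ^ (1 - θ) := by
    rw [one_div_mul_eq_div]; gcongr; linarith
  have h4 : (t - 1) * σ₁ ≤ 1 / (1 - θ) * (σ₁ * t) := by
    have : 1 ≤ 1 / (1 - θ) := by rw [le_div_iff₀ hθ]; linarith
    have h5 : 0 ≤ σ₁ * t := by positivity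
    nlinarith
  have h6 := mul_le_mul_of_nonneg_left h3 (norm_nonneg (u₂ - u₁))
  linarith
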